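/- Let f be an entire function satisfying the Separation Property and Δ a bounded forward invariant Siegel disk of f. Then any hidden component of Δ is either preperiodic to Δ itself or is a wandering domain with bounded orbit. -/

import Mathlib

open Set Topology Bornology Filter Metric

noncomputable section

/-- The "hat" of a bounded set: its closure together with all bounded connected
components of the complement of its closure. -/
def hat (X : Set ℂ) : Set ℂ :=
  closure X ∪ {z | z ∉ closure X ∧ IsBounded (connectedComponentIn (closure X)ᶜ z)}

/-- The ω-limit set of the orbit of `x` under `f`. -/
def omegaSet (f : ℂ → ℂ) (x : ℂ) : Set ℂ :=
  {y | MapClusterPt y atTop fun n => f^[n] x}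

/-- `v` is a singular value of `f`: on no open neighborhood of `v` are all branches of
the inverse well defined and univalent. -/
def IsSingularValue (f : ℂ → ℂ) (v : ℂ) : Prop :=
  ∀ V : Set ℂ, IsOpen V → v ∈ V →
    ∃ x ∈ f ⁻¹' V, ¬ (Set.InjOn f (connectedComponentIn (f ⁻¹' V) x) ∧
      f '' connectedComponentIn (f ⁻¹' V) x = V)

/-- The Fatou set: points near which the family of iterates is normal (equicontinuous). -/
def fatouSet (f : ℂ → ℂ) : Set ℂ :=
  {z | ∃ U ∈ 𝓝 z, IsOpen U ∧ EquicontinuousOn (fun n : ℕ => f^[n]) U}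

/-- `φ` is a biholomorphism from `A` onto `B`. -/
def Biholo (φ : ℂ → ℂ) (A B : Set ℂ) : Prop :=
  DifferentiableOn ℂ φ A ∧ Set.InjOn φ A ∧ φ '' A = B

/-- `Δ` is a forward invariant Siegel disk of `f` with rotation number `θ`. -/
def IsSiegelDisk (f : ℂ → ℂ) (Δ : Set ℂ) (θ : ℝ) : Prop :=
  IsOpen Δ ∧ IsConnected Δ ∧ f '' Δ = Δ ∧ Δ ⊆ fatouSet f ∧ Irrational θ ∧
  ∃ φ : ℂ → ℂ, Biholo φ (Metric.ball 0 1) Δ ∧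
    ∀ z ∈ Metric.ball (0:ℂ) 1,
      f (φ z) = φ (Complex.exp (2 * Real.pi * θ * Complex.I) * z)

/-- `U` is a connected component of the Fatou set of `f`. -/
def IsFatouComponent (f : ℂ → ℂ) (U : Set ℂ) : Prop :=
  ∃ z ∈ fatouSet f, U = connectedComponentIn (fatouSet f) z

/-- A periodic Fatou component. -/
def IsPeriodicFatouComponent (f : ℂ → ℂ) (U : Set ℂ) : Prop :=
  IsFatouComponent f U ∧ ∃ n : ℕ, 0 < n ∧ f^[n] '' U ⊆ U

/-- The Separation Property: closures of any two distinct periodic Fatou components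
intersect in at most one point. -/
def SeparationProperty (f : ℂ → ℂ) : Prop :=
  ∀ U V : Set ℂ, IsPeriodicFatouComponent f U → IsPeriodicFatouComponent f V →
    U ≠ V → (closure U ∩ closure V).Subsingleton

/-- A wandering domain: a Fatou component whose forward images lie in pairwise
distinct Fatou components. -/
def IsWanderingDomain (f : ℂ → ℂ) (U : Set ℂ) : Prop :=
  IsFatouComponent f U ∧
  ∀ m n : ℕ, m < n → ∀ z ∈ U,
    connectedComponentIn (fatouSet f) (f^[m] z) ≠ connectedComponentIn (fatouSet f) (f^[n] z)

/-- Only the finite set `S` of singular values interacts with the Siegel disk `Δ`. -/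
def InteractingSingularSet (f : ℂ → ℂ) (Δ : Set ℂ) (S : Set ℂ) : Prop :=
  S.Finite ∧ S ⊆ {v | IsSingularValue f v} ∧
  (∀ s ∈ S, (omegaSet f s ∩ hat Δ).Nonempty) ∧
  closure (⋃ s ∈ {v | IsSingularValue f v} \ S, omegaSet f s) ∩ hat Δ = ∅ ∧
  closure ({v | IsSingularValue f v} \ S) ∩ frontier Δ = ∅

/-- `θ` is a Herman number: every analytic orientation preserving circle diffeomorphism
(given by its lift) with rotation number `θ` is analytically linearizable. -/
def IsHermanNumber (θ : ℝ) : Prop :=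
  ∀ F : ℝ → ℝ, AnalyticOnNhd ℝ F Set.univ → StrictMono F →
    (∀ x, F (x + 1) = F x + 1) → (∀ x, 0 < deriv F x) →
    (∀ x : ℝ, Filter.Tendsto (fun n : ℕ => (F^[n] x - x) / n) Filter.atTop (nhds θ)) →
    ∃ H : ℝ → ℝ, AnalyticOnNhd ℝ H Set.univ ∧ StrictMono H ∧
      (∀ x, H (x + 1) = H x + 1) ∧ ∀ x, H (F x) = H x + θ

/-- `f` restricted to `U` is a holomorphic covering of `V`. -/
def IsHolCoveringOn (f : ℂ → ℂ) (U V : Set ℂ) : Prop :=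
  DifferentiableOn ℂ f U ∧ f '' U = V ∧
  ∀ v ∈ V, ∃ W, IsOpen W ∧ v ∈ W ∧ W ⊆ V ∧
    ∀ x ∈ U ∩ f ⁻¹' W, Set.BijOn f (connectedComponentIn (U ∩ f ⁻¹' W) x) W

/-- A uniformly bounded family of holomorphic functions on an open set is equicontinuous there. -/
theorem equicontinuousAt_of_differentiableOn_of_norm_le {ι : Type*} {F : ι → ℂ → ℂ} {B : Set ℂ}
    {M : ℝ} (hB : IsOpen B) (hF : ∀ i, DifferentiableOn ℂ (F i) B)
    (hM : ∀ i, ∀ z ∈ B, ‖F i z‖ ≤ M) {x : ℂ} (hx : x ∈ B) : EquicontinuousAt F x := by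
  obtain ⟨r, hr, hrB⟩ := Metric.isOpen_iff.1 hB x hx
  refine Metric.equicontinuousAt_of_continuity_modulus (fun y => 2 * M / r * dist y x) ?_ F ?_
  · have : Continuous fun y => 2 * M / r * dist y x := by fun_prop
    simpa using this.tendsto x
  · filter_upwards [Metric.ball_mem_nhds x hr] with y hy i
    rw [dist_comm]
    refine Complex.dist_le_div_mul_dist_of_mapsTo_ball ((hF i).mono hrB) (fun w hw => ?_) hy
    rw [mem_closedBall]
    linarith [dist_le_norm_add_norm (F i w) (F i x), hM i w (hrB hw), hM i x hx]

/-- Normality in terms of ultrafilters: a uniformly bounded sequence of holomorphic functions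
converges along the hyperfilter to a holomorphic function. -/
theorem exists_differentiableOn_tendsto_hyperfilter {F : ℕ → ℂ → ℂ} {B : Set ℂ} {M : ℝ}
    (hB : IsOpen B) (hF : ∀ i, DifferentiableOn ℂ (F i) B) (hM : ∀ i, ∀ z ∈ B, ‖F i z‖ ≤ M) :
    ∃ g : ℂ → ℂ, DifferentiableOn ℂ g B ∧ (∀ z ∈ B, ‖g z‖ ≤ M) ∧
      ∀ z ∈ B, Tendsto (fun n => F n z) (hyperfilter ℕ) (𝓝 (g z)) := by
  have key : ∀ z, ∃ y, z ∈ B → ‖y‖ ≤ M ∧ Tendsto (fun n => F n z) (hyperfilter ℕ) (𝓝 y) := by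
    intro z
    by_cases hz : z ∈ B
    · obtain ⟨y, hy, hle⟩ := (isCompact_closedBall (0 : ℂ) M).ultrafilter_le_nhds
        ((hyperfilter ℕ).map fun n => F n z)
        (by
          rw [Ultrafilter.coe_map, le_principal_iff, mem_map]
          exact Eventually.of_forall fun n => by simpa using hM n z hz)
      exact ⟨y, fun _ => ⟨by simpa using hy, hle⟩⟩
    · exact ⟨0, fun h => absurd h hz⟩
  choose g hg using key
  refine ⟨g, ?_, fun z hz => (hg z hz).1, fun z hz => (hg z hz).2⟩
  refine TendstoLocallyUniformlyOn.differentiableOn (F := F) (φ := (hyperfilter ℕ : Filter ℕ)) ?_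
    (Eventually.of_forall hF) hB
  rw [Metric.tendstoLocallyUniformlyOn_iff]
  intro ε hε x hx
  have heq := equicontinuousAt_of_differentiableOn_of_norm_le hB hF hM hx
  rw [Metric.equicontinuousAt_iff_right] at heq
  refine ⟨{y | y ∈ B ∧ ∀ n, dist (F n x) (F n y) < ε / 4}, ?_, ?_⟩
  · exact mem_nhdsWithin_of_mem_nhds ((hB.eventually_mem hx).and (heq (ε / 4) (by linarith)))
  · filter_upwards [Metric.tendsto_nhds.1 (hg x hx).2 (ε / 4) (by linarith)] with n hn y hy
    have hlim : dist (g x) (g y) ≤ ε / 4 :=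
      le_of_tendsto ((hg x hx).2.dist (hg y hy.1).2) (Eventually.of_forall fun k => (hy.2 k).le)
    have h1 := dist_triangle4 (g y) (g x) (F n x) (F n y)
    rw [dist_comm (g y) (g x), dist_comm (g x) (F n x)] at h1
    linarith [hy.2 n]

/-- The Fourier averages of a power series along an irrational rotation pick out a single term. -/
theorem tendsto_average_tsum {a : ℕ → ℂ} {lam w : ℂ} (hlam : ‖lam‖ = 1)
    (hroot : ∀ n : ℕ, 0 < n → lam ^ n ≠ 1) (hs : Summable fun j => a j * w ^ j) (n : ℕ) :
    Tendsto (fun N : ℕ => (N : ℂ)⁻¹ *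
        ∑ k ∈ Finset.range N, (lam ^ (n * k))⁻¹ * ∑' j, a j * (lam ^ k * w) ^ j)
      atTop (𝓝 (a n * w ^ n)) := by
  have hl0 : lam ≠ 0 := by rintro rfl; simp at hlam
  have hsk : ∀ k : ℕ, Summable fun j => a j * (lam ^ k * w) ^ j := fun k => by
    refine Summable.of_norm (hs.norm.congr fun j => ?_)
    simp [hlam]
  have hrw : ∀ N : ℕ, (N : ℂ)⁻¹ *
      ∑ k ∈ Finset.range N, (lam ^ (n * k))⁻¹ * ∑' j, a j * (lam ^ k * w) ^ j =
      ∑' j, a j * w ^ j * ((N : ℂ)⁻¹ * ∑ k ∈ Finset.range N, ((lam ^ n)⁻¹ * lam ^ j) ^ k) := by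
    intro N
    simp_rw [← tsum_mul_left]
    rw [← Summable.tsum_finsetSum fun k _ => (hsk k).mul_left _, ← tsum_mul_left]
    refine tsum_congr fun j => ?_
    rw [Finset.mul_sum, Finset.mul_sum, Finset.mul_sum]
    refine Finset.sum_congr rfl fun k _ => ?_
    rw [mul_pow, mul_pow, inv_pow, ← pow_mul, ← pow_mul, ← pow_mul, mul_comm k j]
    ring
  simp_rw [hrw]
  have hq : ∀ j, ‖(lam ^ n)⁻¹ * lam ^ j‖ = 1 := fun j => by simp [hlam]
  have hlim : ∀ j, Tendsto (fun N : ℕ => a j * w ^ j *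
      ((N : ℂ)⁻¹ * ∑ k ∈ Finset.range N, ((lam ^ n)⁻¹ * lam ^ j) ^ k)) atTop
      (𝓝 (if j = n then a n * w ^ n else 0)) := by
    intro j
    split_ifs with hj
    · subst hj
      refine tendsto_const_nhds.congr' ?_
      filter_upwards [eventually_ne_atTop 0] with N hN
      have : (lam ^ j)⁻¹ * lam ^ j = 1 := inv_mul_cancel₀ (pow_ne_zero _ hl0)
      have hN' : (N : ℂ) ≠ 0 := by exact_mod_cast hN
      simp [this, hN']
    · have hne : (lam ^ n)⁻¹ * lam ^ j ≠ 1 := by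
        intro h
        have h' : lam ^ j = lam ^ n := by
          rwa [inv_mul_eq_one₀ (pow_ne_zero _ hl0), eq_comm] at h
        rcases lt_or_gt_of_ne hj with hlt | hlt
        · refine hroot (n - j) (by omega) ?_
          rw [pow_sub₀ _ hl0 hlt.le, h', mul_inv_cancel₀ (pow_ne_zero _ hl0)]
        · refine hroot (j - n) (by omega) ?_
          rw [pow_sub₀ _ hl0 hlt.le, h', mul_inv_cancel₀ (pow_ne_zero _ hl0)]
      rw [← mul_zero (a j * w ^ j)]
      refine Tendsto.const_mul _ ?_
      set q := (lam ^ n)⁻¹ * lam ^ j with hqdef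
      refine squeeze_zero_norm (a := fun N : ℕ => (N : ℝ)⁻¹ * (2 / ‖q - 1‖)) (fun N => ?_) ?_
      · rw [geom_sum_eq hne, norm_mul, norm_inv, Complex.norm_natCast, norm_div]
        gcongr
        refine (norm_sub_le _ _).trans ?_
        rw [norm_pow, hq, one_pow, norm_one]
        norm_num
      · simpa using (tendsto_inv_atTop_nhds_zero_nat (𝕜 := ℝ)).mul_const (2 / ‖q - 1‖)
  have := tendsto_tsum_of_dominated_convergence (𝓕 := atTop) hs.norm hlim
    (Eventually.of_forall fun N j => by
      rw [norm_mul]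
      refine mul_le_of_le_one_right (norm_nonneg _) ?_
      rw [norm_mul, norm_inv, Complex.norm_natCast]
      rcases Nat.eq_zero_or_pos N with rfl | hN
      · simp
      · rw [inv_mul_le_iff₀ (by exact_mod_cast hN), mul_one]
        refine (norm_sum_le _ _).trans ?_
        simp only [norm_pow, hq, one_pow]
        simp)
  simpa using this

/-- If an invariant disk linearized by `φ` has a boundary point near which the iterates are
bounded, then `φ` extends holomorphically to a strictly larger disk. -/
theorem exists_extension_of_norm_iterate_le {f φ : ℂ → ℂ} {lam p : ℂ} {B : Set ℂ} {M : ℝ}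
    (hf : Differentiable ℂ f) (hlam : ‖lam‖ = 1) (hroot : ∀ n : ℕ, 0 < n → lam ^ n ≠ 1)
    (hφ : DifferentiableOn ℂ φ (ball 0 1)) (hinj : InjOn φ (ball 0 1))
    (hconj : ∀ w ∈ ball (0 : ℂ) 1, f (φ w) = φ (lam * w))
    (hB : IsOpen B) (hBc : IsPreconnected B) (hpB : p ∈ B) (hp : p ∉ φ '' ball 0 1)
    (hpcl : p ∈ closure (φ '' ball 0 1)) (hopen : IsOpen (φ '' ball 0 1))
    (hM : ∀ n, ∀ z ∈ B, ‖f^[n] z‖ ≤ M) :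
    ∃ (Φ : ℂ → ℂ) (s : ℝ), 1 < s ∧ DifferentiableOn ℂ Φ (ball 0 s) ∧ EqOn Φ φ (ball 0 1) := by
  obtain ⟨a, ha⟩ : ∃ a : ℕ → ℂ, ∀ w ∈ ball (0 : ℂ) 1, HasSum (fun n => a n * w ^ n) (φ w) := by
    refine ⟨fun n => (n.factorial : ℂ)⁻¹ * iteratedDeriv n φ 0, fun w hw => ?_⟩
    refine (Complex.hasSum_taylorSeries_on_ball hφ hw).congr_fun fun n => ?_
    simp only [sub_zero, smul_eq_mul]
    ring
  have hlamw : ∀ (k : ℕ), ∀ w ∈ ball (0 : ℂ) 1, lam ^ k * w ∈ ball (0 : ℂ) 1 := by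
    intro k w hw
    simpa [hlam] using hw
  have hiter : ∀ (k : ℕ), ∀ w ∈ ball (0 : ℂ) 1, f^[k] (φ w) = φ (lam ^ k * w) := by
    intro k w hw
    induction k with
    | zero => simp
    | succ k ih => rw [Function.iterate_succ_apply', ih, hconj _ (hlamw k w hw), pow_succ']; ring_nf
  obtain ⟨x₀, hx₀B, w₀, hw₀, hw₀x⟩ := mem_closure_iff.1 hpcl B hB hpB
  have hM0 : 0 ≤ M := (norm_nonneg _).trans (hM 0 p hpB)
  -- the Fourier coefficients extend holomorphically to `B`
  have hcoef : ∀ n, ∃ g : ℂ → ℂ, DifferentiableOn ℂ g B ∧ (∀ z ∈ B, ‖g z‖ ≤ M) ∧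
      ∀ w ∈ ball (0 : ℂ) 1, φ w ∈ B → g (φ w) = a n * w ^ n := by
    intro n
    obtain ⟨g, hg, hgM, hlim⟩ := exists_differentiableOn_tendsto_hyperfilter (M := M)
      (F := fun N z => (N : ℂ)⁻¹ * ∑ k ∈ Finset.range N, (lam ^ (n * k))⁻¹ * f^[k] z) hB
      (fun N => by
        refine DifferentiableOn.const_mul (DifferentiableOn.fun_sum fun k _ => ?_) _
        exact ((hf.iterate k).differentiableOn).const_mul _)
      (fun N z hz => by
        rw [norm_mul, norm_inv, Complex.norm_natCast]
        rcases Nat.eq_zero_or_pos N with rfl | hN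
        · simpa using hM0
        · rw [inv_mul_le_iff₀ (by exact_mod_cast hN)]
          refine (norm_sum_le_of_le _ (f := fun k => (lam ^ (n * k))⁻¹ * f^[k] z)
            (n := fun _ => M) fun k _ => ?_).trans_eq (by simp)
          simpa [hlam] using hM k z hz)
    refine ⟨g, hg, hgM, fun w hw hwB => ?_⟩
    refine tendsto_nhds_unique (hlim _ hwB) ?_
    have := (tendsto_average_tsum hlam hroot (ha w hw).summable n).mono_left
      Nat.hyperfilter_le_atTop
    refine this.congr fun N => ?_
    congr 1
    refine Finset.sum_congr rfl fun k _ => ?_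
    rw [(ha _ (hlamw k w hw)).tsum_eq, hiter k w hw]
  choose g hg hgM hgφ using hcoef
  obtain ⟨m, hm, ham⟩ : ∃ m, 0 < m ∧ a m ≠ 0 := by
    by_contra! h
    have hconst : ∀ w ∈ ball (0 : ℂ) 1, φ w = a 0 := fun w hw => by
      refine (ha w hw).unique ?_
      simpa using hasSum_single (f := fun n => a n * w ^ n) 0 fun n hn => by
        simp [h n (Nat.pos_of_ne_zero hn)]
    have h0 : (0 : ℂ) ∈ ball (0 : ℂ) 1 := by simp
    have h1 : (1 / 2 : ℂ) ∈ ball (0 : ℂ) 1 := by norm_num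
    have := hinj h0 h1 ((hconst _ h0).trans (hconst _ h1).symm)
    norm_num at this
  have ham' : 0 < ‖a m‖ := norm_pos_iff.2 ham
  have hgp : ‖a m‖ ≤ ‖g m p‖ := by
    have hcont : ContinuousAt (g m) p := (hg m).continuousOn.continuousAt (hB.mem_nhds hpB)
    have hr : ∀ r ∈ Ioo (0 : ℝ) 1, ‖a m‖ * r ^ m ≤ ‖g m p‖ := by
      intro r hr
      have hsub : closedBall (0 : ℂ) r ⊆ ball 0 1 := closedBall_subset_ball hr.2
      have hK : IsClosed (φ '' closedBall 0 r) :=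
        ((isCompact_closedBall _ _).image_of_continuousOn (hφ.continuousOn.mono hsub)).isClosed
      have hpK : p ∉ φ '' closedBall 0 r := fun h => hp (image_mono hsub h)
      have hfreq : ∃ᶠ x in 𝓝 p, x ∈ φ '' ball 0 1 := mem_closure_iff_frequently.1 hpcl
      refine ge_of_tendsto_of_frequently hcont.norm.tendsto ((hfreq.and_eventually
        ((hB.eventually_mem hpB).and (hK.isOpen_compl.eventually_mem hpK))).mono ?_)
      rintro _ ⟨⟨w, hw, rfl⟩, hwB, hwK⟩
      rw [hgφ m w hw hwB, norm_mul, norm_pow]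
      have : r ≤ ‖w‖ := by
        by_contra! h
        exact hwK ⟨w, by simpa using h.le, rfl⟩
      have := hr.1.le
      gcongr
    have hlim : Tendsto (fun r : ℝ => ‖a m‖ * r ^ m) (𝓝[<] 1) (𝓝 (‖a m‖ * 1 ^ m)) :=
      (Continuous.tendsto (by fun_prop) 1).mono_left nhdsWithin_le_nhds
    rw [one_pow, mul_one] at hlim
    exact le_of_tendsto hlim (by
      filter_upwards [Ioo_mem_nhdsLT (zero_lt_one' ℝ)] with r hr' using hr r hr')
  obtain ⟨z, hzB, hz⟩ : ∃ z ∈ B, ‖a m‖ < ‖g m z‖ := by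
    by_contra! h
    have := Complex.norm_eqOn_of_isPreconnected_of_isMaxOn hBc hB (hg m) hpB
      (fun x hx => (h x hx).trans hgp) hx₀B
    simp only [Function.comp_apply, Function.const_apply] at this
    rw [← hw₀x] at this hx₀B
    rw [hgφ m w₀ hw₀ hx₀B, norm_mul, norm_pow] at this
    have hlt : ‖w₀‖ ^ m < 1 := pow_lt_one₀ (norm_nonneg _) (by simpa using hw₀) hm.ne'
    nlinarith
  -- hence the Taylor coefficients of `φ` decay geometrically
  set ρ : ℝ := ‖g m z‖ / ‖a m‖ with hρ
  have hρ1 : 1 < ρ := (one_lt_div ham').2 hz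
  set s : ℝ := ρ ^ ((m : ℝ)⁻¹) with hs
  have hs1 : 1 < s := Real.one_lt_rpow hρ1 (by positivity)
  have hsm : s ^ m = ρ := Real.rpow_inv_natCast_pow (by linarith) hm.ne'
  have hbound : ∀ n, ‖a n‖ * s ^ n ≤ M := by
    intro n
    have heq : EqOn (fun x => g m x ^ n * a n ^ m) (fun x => g n x ^ m * a m ^ n) B := by
      refine AnalyticOnNhd.eqOn_of_preconnected_of_eventuallyEq
        ((((hg m).pow n).mul_const _).analyticOnNhd hB)
        ((((hg n).pow m).mul_const _).analyticOnNhd hB) hBc hx₀B ?_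
      filter_upwards [hB.mem_nhds hx₀B, hopen.mem_nhds ⟨w₀, hw₀, hw₀x⟩]
      rintro _ hxB ⟨w, hw, rfl⟩
      simp only [hgφ _ w hw hxB]
      ring
    have hz' := congrArg norm (heq hzB)
    simp only [norm_mul, norm_pow] at hz'
    refine le_of_pow_le_pow_left₀ hm.ne' hM0 ?_
    have : (‖a n‖ * s ^ n) ^ m = ‖g n z‖ ^ m := by
      rw [mul_pow, ← pow_mul, mul_comm n m, pow_mul, hsm, hρ, div_pow]
      field_simp
      linarith
    rw [this]
    gcongr
    exact hgM n z hzB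
  obtain ⟨t, ht1, hts⟩ := exists_between hs1
  refine ⟨fun w => ∑' n, a n * w ^ n, t, ht1, ?_, fun w hw => (ha w hw).tsum_eq⟩
  have hts' : t / s < 1 := (div_lt_one (by linarith)).2 hts
  refine Complex.differentiableOn_tsum_of_summable_norm (u := fun n => M * (t / s) ^ n)
    ((summable_geometric_of_lt_one (by positivity) hts').mul_left M)
    (fun n => by fun_prop) isOpen_ball fun n w hw => ?_
  have hw' : ‖w‖ ≤ t := by simpa using (mem_ball_zero_iff.1 hw).le
  rw [norm_mul, norm_pow, div_pow]
  calc ‖a n‖ * ‖w‖ ^ n ≤ ‖a n‖ * t ^ n := by gcongr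
    _ = ‖a n‖ * s ^ n * (t ^ n / s ^ n) := by field_simp
    _ ≤ M * (t ^ n / s ^ n) := by
      gcongr
      exact hbound n

theorem isPreconnected_annulus (s : ℝ) : IsPreconnected {w : ℂ | 1 < ‖w‖ ∧ ‖w‖ < s} := by
  have : {w : ℂ | 1 < ‖w‖ ∧ ‖w‖ < s} =
      (fun x : ℝ × ℝ => (x.1 : ℂ) * Complex.exp (x.2 * Complex.I)) '' (Ioo 1 s ×ˢ univ) := by
    ext w
    constructor
    · intro hw
      exact ⟨(‖w‖, w.arg), ⟨hw, mem_univ _⟩, Complex.norm_mul_exp_arg_mul_I w⟩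
    · rintro ⟨⟨r, t⟩, ⟨hr, -⟩, rfl⟩
      have : |r| = r := abs_of_pos (by linarith [hr.1])
      simpa [Complex.norm_exp_ofReal_mul_I, this] using hr
  rw [this]
  exact (isPreconnected_Ioo.prod isPreconnected_univ).image _ (by fun_prop)

/-- A holomorphic map commuting with an irrational rotation and injective near `0` is injective. -/
theorem injOn_ball_of_semiconj_rotation {f Φ : ℂ → ℂ} {lam : ℂ} {s : ℝ} (hlam : ‖lam‖ = 1)
    (hroot : ∀ n : ℕ, 0 < n → lam ^ n ≠ 1) (hs : 1 < s) (hΦ : DifferentiableOn ℂ Φ (ball 0 s))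
    (hinj : InjOn Φ (ball 0 1)) (hconj : ∀ w ∈ ball (0 : ℂ) s, f (Φ w) = Φ (lam * w)) :
    InjOn Φ (ball 0 s) := by
  intro w hw v hv hwv
  have hs0 : 0 < s := by linarith
  have hiter : ∀ k : ℕ, Φ (lam ^ k * w) = Φ (lam ^ k * v) := by
    intro k
    induction k with
    | zero => simpa using hwv
    | succ k ih =>
      have h1 : lam ^ k * w ∈ ball (0 : ℂ) s := by simpa [hlam] using hw
      have h2 : lam ^ k * v ∈ ball (0 : ℂ) s := by simpa [hlam] using hv
      rw [pow_succ', mul_assoc, mul_assoc, ← hconj _ h1, ← hconj _ h2, ih]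
  obtain ⟨t, hts, hw', hv'⟩ : ∃ t, t < s ∧ ‖w‖ < t ∧ ‖v‖ < t := by
    obtain ⟨t, h1, h2⟩ := exists_between (max_lt (mem_ball_zero_iff.1 hw) (mem_ball_zero_iff.1 hv))
    exact ⟨t, h2, (le_max_left _ _).trans_lt h1, (le_max_right _ _).trans_lt h1⟩
  have ht0 : 0 < t := (norm_nonneg _).trans_lt hw'
  have hmaps : ∀ u : ℂ, ‖u‖ < t → MapsTo (fun ζ => ζ * u) (ball 0 (s / t)) (ball 0 s) := by
    intro u hu ζ hζ
    rw [mem_ball_zero_iff] at hζ ⊢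
    rw [norm_mul]
    calc ‖ζ‖ * ‖u‖ ≤ ‖ζ‖ * t := by gcongr
      _ < s / t * t := by gcongr
      _ = s := by field_simp
  have han : ∀ u : ℂ, ‖u‖ < t → AnalyticOnNhd ℂ (fun ζ => Φ (ζ * u)) (ball 0 (s / t)) :=
    fun u hu => (hΦ.comp (by fun_prop) (hmaps u hu)).analyticOnNhd isOpen_ball
  have hpow : Function.Injective fun k : ℕ => lam ^ k := by
    have hl0 : lam ≠ 0 := by rintro rfl; simp at hlam
    have key : ∀ i j : ℕ, i < j → lam ^ i ≠ lam ^ j := fun i j hij h => by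
      refine hroot (j - i) (by omega) ?_
      rw [pow_sub₀ _ hl0 hij.le, ← h, mul_inv_cancel₀ (pow_ne_zero _ hl0)]
    intro i j h
    rcases lt_trichotomy i j with hij | hij | hij
    · exact absurd h (key i j hij)
    · exact hij
    · exact absurd h.symm (key j i hij)
  obtain ⟨ζ₀, hζ₀, hacc⟩ := (infinite_range_of_injective hpow).exists_accPt_of_subset_isCompact
    (isCompact_closedBall (0 : ℂ) 1) (by rintro _ ⟨k, rfl⟩; simp [hlam])
  have hζ₀' : ζ₀ ∈ ball (0 : ℂ) (s / t) :=
    closedBall_subset_ball ((one_lt_div ht0).2 hts) hζ₀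
  have heq : EqOn (fun ζ => Φ (ζ * w)) (fun ζ => Φ (ζ * v)) (ball 0 (s / t)) := by
    refine (han w hw').eqOn_of_preconnected_of_frequently_eq (han v hv')
      (convex_ball _ _).isPreconnected hζ₀' ?_
    rw [accPt_iff_frequently_nhdsNE] at hacc
    refine hacc.mono ?_
    rintro _ ⟨k, rfl⟩
    exact hiter k
  have hst : (1 / s : ℝ) < s / t := by
    rw [div_lt_div_iff₀ hs0 ht0]
    nlinarith
  have hsmall : ∀ u ∈ ball (0 : ℂ) s, ((1 / s : ℝ) : ℂ) * u ∈ ball (0 : ℂ) 1 := by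
    intro u hu
    rw [mem_ball_zero_iff] at hu ⊢
    rw [norm_mul, Complex.norm_real, Real.norm_of_nonneg (by positivity), one_div,
      inv_mul_lt_iff₀ hs0]
    linarith
  have := hinj (hsmall w hw) (hsmall v hv) (heq (by
    rw [mem_ball_zero_iff, Complex.norm_real, Real.norm_of_nonneg (by positivity)]
    exact hst))
  refine mul_left_cancel₀ ?_ this
  have : (1 / s : ℝ) ≠ 0 := by positivity
  exact_mod_cast this

theorem frontier_connectedComponentIn_compl_subset {X : Type*} [TopologicalSpace X]
    [LocallyConnectedSpace X] {K : Set X} (hK : IsClosed K) (z : X) :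
    frontier (connectedComponentIn Kᶜ z) ⊆ K := by
  intro q hq
  rw [hK.isOpen_compl.connectedComponentIn.frontier_eq] at hq
  by_contra hqK
  obtain ⟨x, hx1, hx2⟩ := mem_closure_iff.1 hq.1 _
    hK.isOpen_compl.connectedComponentIn (mem_connectedComponentIn hqK)
  refine hq.2 ?_
  rw [connectedComponentIn_eq hx2, ← connectedComponentIn_eq hx1]
  exact mem_connectedComponentIn hqK

/-- If a linearization of `Δ` extends injectively past the unit circle, then `Δ` has no hidden
component. -/
theorem not_isBounded_component_of_extension {Φ : ℂ → ℂ} {s : ℝ} {Δ : Set ℂ} (hs : 1 < s)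
    (hΦ : DifferentiableOn ℂ Φ (ball 0 s)) (hinj : InjOn Φ (ball 0 s)) (hΔ : Φ '' ball 0 1 = Δ)
    (hb : IsBounded Δ) {z : ℂ} (hz : z ∉ closure Δ) :
    ¬ IsBounded (connectedComponentIn (closure Δ)ᶜ z) := by
  intro hbz
  have hs0 : (0 : ℝ) < s := by linarith
  have hsub : closedBall (0 : ℂ) 1 ⊆ ball 0 s := closedBall_subset_ball hs
  have hK : closure Δ ⊆ Φ '' closedBall 0 1 := by
    refine closure_minimal (hΔ ▸ image_mono ball_subset_closedBall) ?_
    exact ((isCompact_closedBall _ _).image_of_continuousOn (hΦ.continuousOn.mono hsub)).isClosed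
  set A : Set ℂ := {w | 1 < ‖w‖ ∧ ‖w‖ < s} with hA
  have hAs : A ⊆ ball 0 s := fun w hw => by simpa using hw.2
  have hAK : Φ '' A ⊆ (closure Δ)ᶜ := by
    rintro _ ⟨w, hw, rfl⟩ hmem
    obtain ⟨v, hv, hvw⟩ := hK hmem
    have := hinj (hsub hv) (hAs hw) hvw
    rw [mem_closedBall_zero_iff, this] at hv
    exact absurd hw.1 (not_lt.2 hv)
  have hApre : IsPreconnected (Φ '' A) :=
    (isPreconnected_annulus s).image _ (hΦ.continuousOn.mono hAs)
  have hΦopen : IsOpen (Φ '' ball 0 s) := by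
    rcases (hΦ.analyticOnNhd isOpen_ball).is_constant_or_isOpen
      (convex_ball (0 : ℂ) s).isPreconnected with ⟨c, hc⟩ | h
    · have h0 : (0 : ℂ) ∈ ball (0 : ℂ) s := by simpa using hs0
      have h1 : (1 : ℂ) ∈ ball (0 : ℂ) s := by simpa using hs
      exact absurd (hinj h0 h1 ((hc _ h0).trans (hc _ h1).symm)) zero_ne_one
    · exact h _ subset_rfl isOpen_ball
  have hcomp : ∀ y ∉ closure Δ, Φ '' A ⊆ connectedComponentIn (closure Δ)ᶜ y := by
    intro y hy
    set C := connectedComponentIn (closure Δ)ᶜ y with hC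
    have hyC : y ∈ C := mem_connectedComponentIn hy
    have hCne : C ≠ univ := by
      intro h
      have h0 : Φ 0 ∈ closure Δ := subset_closure (hΔ ▸ mem_image_of_mem _ (by simp))
      exact connectedComponentIn_subset _ _ (h ▸ mem_univ (Φ 0) : Φ 0 ∈ C) h0
    obtain ⟨q, hq⟩ := nonempty_frontier_iff.2 ⟨⟨y, hyC⟩, hCne⟩
    have hqK : q ∈ closure Δ :=
      frontier_connectedComponentIn_compl_subset isClosed_closure y hq
    obtain ⟨x, ⟨w, hw, rfl⟩, hxC⟩ := mem_closure_iff.1 (frontier_subset_closure hq) _ hΦopen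
      (image_mono hsub (hK hqK))
    have hwA : w ∈ A := by
      refine ⟨?_, by simpa using hw⟩
      by_contra! hle
      refine connectedComponentIn_subset _ _ hxC ?_
      have hwcl : w ∈ closure (ball (0 : ℂ) 1) := by
        rw [closure_ball _ one_ne_zero]; simpa using hle
      rw [← hΔ]
      exact ((hΦ.continuousOn.continuousAt (isOpen_ball.mem_nhds hw)).continuousWithinAt
        ).mem_closure_image hwcl
    rw [hC, connectedComponentIn_eq hxC]
    exact hApre.subset_connectedComponentIn (mem_image_of_mem _ hwA) hAK
  obtain ⟨r, hr1, hrs⟩ := exists_between hs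
  have hrA : (r : ℂ) ∈ A := by
    have : |r| = r := abs_of_pos (by linarith)
    simpa [hA, this] using ⟨hr1, hrs⟩
  have hx := mem_image_of_mem Φ hrA
  refine NormedSpace.unbounded_univ ℂ ℂ ((hb.closure.union hbz).subset fun y _ => ?_)
  by_cases hy : y ∈ closure Δ
  · exact Or.inl hy
  · refine Or.inr ?_
    rw [connectedComponentIn_eq (hcomp z hz hx), ← connectedComponentIn_eq (hcomp y hy hx)]
    exact mem_connectedComponentIn hy

theorem mem_fatouSet_iff {f : ℂ → ℂ} {z : ℂ} :
    z ∈ fatouSet f ↔ ∀ᶠ x in 𝓝 z, EquicontinuousAt (fun n : ℕ => f^[n]) x := by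
  have key : ∀ U : Set ℂ, IsOpen U → ∀ x ∈ U,
      (EquicontinuousWithinAt (fun n : ℕ => f^[n]) U x ↔
        EquicontinuousAt (fun n : ℕ => f^[n]) x) := fun U hU x hx => by
    rw [EquicontinuousWithinAt, EquicontinuousAt, hU.nhdsWithin_eq hx]
  constructor
  · rintro ⟨U, hzU, hU, h⟩
    filter_upwards [hzU] with x hx using (key U hU x hx).1 (h x hx)
  · intro h
    obtain ⟨U, hUs, hU, hz⟩ := _root_.eventually_nhds_iff.1 h
    exact ⟨U, hU.mem_nhds hz, hU, fun x hx => (key U hU x hx).2 (hUs x hx)⟩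

theorem isOpen_fatouSet (f : ℂ → ℂ) : IsOpen (fatouSet f) := by
  have : fatouSet f = {z | ∀ᶠ x in 𝓝 z, EquicontinuousAt (fun n : ℕ => f^[n]) x} :=
    Set.ext fun _ => mem_fatouSet_iff
  rw [this]
  exact isOpen_setOfPred_eventually_nhds

theorem subset_fatouSet_of_norm_iterate_le {f : ℂ → ℂ} {B : Set ℂ} {M : ℝ}
    (hf : Differentiable ℂ f) (hB : IsOpen B) (hM : ∀ n, ∀ z ∈ B, ‖f^[n] z‖ ≤ M) :
    B ⊆ fatouSet f := fun z hz => mem_fatouSet_iff.2 <| by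
  filter_upwards [hB.mem_nhds hz] with x hx
  exact equicontinuousAt_of_differentiableOn_of_norm_le hB
    (fun n => (hf.iterate n).differentiableOn) hM hx

theorem mapsTo_fatouSet {f : ℂ → ℂ} (hopen : IsOpenMap f) : MapsTo f (fatouSet f) (fatouSet f) := by
  intro z hz
  rw [mem_fatouSet_iff] at hz ⊢
  refine Eventually.filter_mono (hopen.nhds_le z) (eventually_map.2 (hz.mono fun x hx => ?_))
  intro V hV
  exact Eventually.filter_mono (hopen.nhds_le x)
    (eventually_map.2 ((hx V hV).mono fun y hy n => hy (n + 1)))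

/-- A connected open subset of `F` whose frontier misses `F` is a component of `F`. -/
theorem eq_connectedComponentIn_of_disjoint_frontier {X : Type*} [TopologicalSpace X]
    {U F : Set X} {z : X} (hU : IsOpen U) (hc : IsPreconnected U) (hUF : U ⊆ F)
    (hfr : ∀ x ∈ closure U, x ∈ F → x ∈ U) (hz : z ∈ U) : U = connectedComponentIn F z := by
  refine (hc.subset_connectedComponentIn hz hUF).antisymm ?_
  have hpre : IsPreconnected (connectedComponentIn F z) := isPreconnected_connectedComponentIn
  refine hpre.subset_of_closure_inter_subset hU ⟨z, mem_connectedComponentIn (hUF hz), hz⟩ ?_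
  rintro x ⟨hx, hxF⟩
  exact hfr x hx (connectedComponentIn_subset _ _ hxF)

theorem IsSiegelDisk.not_subsingleton {f : ℂ → ℂ} {Δ : Set ℂ} {θ : ℝ} (hΔ : IsSiegelDisk f Δ θ) :
    ¬ Δ.Subsingleton := by
  obtain ⟨-, -, -, -, -, φ, ⟨-, hinj, rfl⟩, -⟩ := hΔ
  intro h
  have h0 : (0 : ℂ) ∈ ball (0 : ℂ) 1 := by simp
  have h1 : (1 / 2 : ℂ) ∈ ball (0 : ℂ) 1 := by norm_num
  have := hinj h0 h1 (h (mem_image_of_mem _ h0) (mem_image_of_mem _ h1))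
  norm_num at this

theorem IsSiegelDisk.image_iterate {f : ℂ → ℂ} {Δ : Set ℂ} {θ : ℝ} (hΔ : IsSiegelDisk f Δ θ)
    (n : ℕ) : f^[n] '' Δ = Δ := by
  rw [image_iterate_eq]
  exact Function.iterate_fixed hΔ.2.2.1 n

theorem IsSiegelDisk.mapsTo_iterate_closure {f : ℂ → ℂ} {Δ : Set ℂ} {θ : ℝ}
    (hΔ : IsSiegelDisk f Δ θ) (hf : Continuous f) (n : ℕ) :
    MapsTo f^[n] (closure Δ) (closure Δ) :=
  MapsTo.closure (mapsTo_iff_image_subset.2 (hΔ.image_iterate n).subset) (hf.iterate n)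

theorem IsSiegelDisk.iterate_ne_const {f : ℂ → ℂ} {Δ : Set ℂ} {θ : ℝ} (hΔ : IsSiegelDisk f Δ θ)
    (n : ℕ) (c : ℂ) : ¬ ∀ z, f^[n] z = c := fun h => by
  refine hΔ.not_subsingleton ?_
  rw [← hΔ.image_iterate n]
  rintro _ ⟨x, -, rfl⟩ _ ⟨y, -, rfl⟩
  rw [h, h]

theorem norm_exp_two_pi_mul_I (θ : ℝ) : ‖Complex.exp (2 * Real.pi * θ * Complex.I)‖ = 1 := by
  exact_mod_cast Complex.norm_exp_ofReal_mul_I (2 * Real.pi * θ)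

theorem exp_two_pi_mul_I_pow_ne_one {θ : ℝ} (hθ : Irrational θ) (n : ℕ) (hn : 0 < n) :
    Complex.exp (2 * Real.pi * θ * Complex.I) ^ n ≠ 1 := by
  rw [← Complex.exp_nat_mul, Ne, Complex.exp_eq_one_iff]
  rintro ⟨k, hk⟩
  have h2 : (n : ℂ) * θ = k := by
    refine mul_right_cancel₀ Complex.two_pi_I_ne_zero ?_
    rw [← hk]
    ring
  have h3 : (n : ℝ) * θ = k := by exact_mod_cast h2
  exact (hθ.natCast_mul hn.ne').ne_int k h3

/-- A bounded Siegel disk having a hidden component fills its Fatou component. -/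
theorem IsSiegelDisk.mem_of_mem_closure_of_mem_fatouSet {f : ℂ → ℂ} {Δ : Set ℂ} {θ : ℝ} {z p : ℂ}
    (hΔ : IsSiegelDisk f Δ θ) (hf : Differentiable ℂ f) (hb : IsBounded Δ) (hz : z ∉ closure Δ)
    (hbz : IsBounded (connectedComponentIn (closure Δ)ᶜ z)) (hp : p ∈ closure Δ)
    (hpF : p ∈ fatouSet f) : p ∈ Δ := by
  by_contra hpΔ
  have hmaps := hΔ.mapsTo_iterate_closure hf.continuous
  obtain ⟨hopen, -, -, -, hθ, φ, ⟨hφ, hinj, himg⟩, hconj⟩ := hΔ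
  set lam := Complex.exp (2 * Real.pi * θ * Complex.I) with hlam_def
  have hlam : ‖lam‖ = 1 := norm_exp_two_pi_mul_I θ
  have hroot : ∀ n : ℕ, 0 < n → lam ^ n ≠ 1 := exp_two_pi_mul_I_pow_ne_one hθ
  obtain ⟨M, hM⟩ := hb.closure.exists_norm_le
  have heq := (mem_fatouSet_iff.1 hpF).self_of_nhds
  rw [Metric.equicontinuousAt_iff] at heq
  obtain ⟨δ, hδ, hδ'⟩ := heq 1 one_pos
  have hBM : ∀ n, ∀ x ∈ ball p δ, ‖f^[n] x‖ ≤ M + 1 := by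
    intro n x hx
    have h1 := hδ' x hx n
    have h2 := hM _ (hmaps n hp)
    rw [dist_comm, dist_eq_norm] at h1
    linarith [norm_le_norm_add_norm_sub' (f^[n] x) (f^[n] p), norm_sub_rev (f^[n] x) (f^[n] p)]
  obtain ⟨Φ, s, hs, hΦ, hΦφ⟩ := exists_extension_of_norm_iterate_le hf hlam hroot hφ hinj hconj
    isOpen_ball (convex_ball p δ).isPreconnected (mem_ball_self hδ) (himg ▸ hpΔ) (himg ▸ hp)
    (himg ▸ hopen) hBM
  have hs0 : 0 < s := by linarith
  have hΦconj : EqOn (fun w => f (Φ w)) (fun w => Φ (lam * w)) (ball 0 s) := by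
    have hrot : MapsTo (fun w => lam * w) (ball 0 s) (ball 0 s) := fun w hw => by
      simpa [hlam] using hw
    refine AnalyticOnNhd.eqOn_of_preconnected_of_eventuallyEq
      ((hf.comp_differentiableOn hΦ).analyticOnNhd isOpen_ball)
      ((hΦ.comp (by fun_prop) hrot).analyticOnNhd isOpen_ball) (convex_ball _ _).isPreconnected
      (mem_ball_self hs0) ?_
    filter_upwards [ball_mem_nhds (0 : ℂ) one_pos] with w hw
    have hw' : lam * w ∈ ball (0 : ℂ) 1 := by simpa [hlam] using hw
    simp only [hΦφ hw, hΦφ hw', hconj w hw]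
  exact not_isBounded_component_of_extension hs hΦ
    (injOn_ball_of_semiconj_rotation hlam hroot hs hΦ (hinj.congr hΦφ.symm) hΦconj)
    (hΦφ.image_eq.trans himg) hb hz hbz

/-- Corollary 2.5: under the Separation Property, every hidden component
is preperiodic to `Δ` or a wandering domain with bounded orbit. -/
theorem stmt14 (f : ℂ → ℂ) (hf : Differentiable ℂ f) (hsep : SeparationProperty f)
    (Δ : Set ℂ) (θ : ℝ) (hΔ : IsSiegelDisk f Δ θ) (hb : IsBounded Δ)
    (z : ℂ) (hz : z ∉ closure Δ)
    (hbz : IsBounded (connectedComponentIn (closure Δ)ᶜ z)) :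
    (∃ n : ℕ, f^[n] '' connectedComponentIn (closure Δ)ᶜ z ⊆ Δ) ∨
    (IsWanderingDomain f (connectedComponentIn (closure Δ)ᶜ z) ∧
      IsBounded (⋃ n : ℕ, f^[n] '' connectedComponentIn (closure Δ)ᶜ z)) := by
  have hfill := fun p => hΔ.mem_of_mem_closure_of_mem_fatouSet (p := p) hf hb hz hbz
  set H := connectedComponentIn (closure Δ)ᶜ z with hH
  have hzH : z ∈ H := mem_connectedComponentIn hz
  have hHo : IsOpen H := isClosed_closure.isOpen_compl.connectedComponentIn
  have hHc : IsPreconnected H := isPreconnected_connectedComponentIn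
  have hHK : H ⊆ (closure Δ)ᶜ := connectedComponentIn_subset _ _
  have hfr : frontier H ⊆ closure Δ :=
    frontier_connectedComponentIn_compl_subset isClosed_closure z
  have hmaps := hΔ.mapsTo_iterate_closure hf.continuous
  obtain ⟨M, hM⟩ := hb.closure.exists_norm_le
  have hHM : ∀ n, ∀ x ∈ H, ‖f^[n] x‖ ≤ M := fun n x hx =>
    Complex.norm_le_of_forall_mem_frontier_norm_le hbz (hf.iterate n).diffContOnCl
      (fun y hy => hM _ (hmaps n (hfr hy))) (subset_closure hx)
  have hHF : H ⊆ fatouSet f := subset_fatouSet_of_norm_iterate_le hf hHo hHM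
  have hHcomp : H = connectedComponentIn (fatouSet f) z := by
    refine eq_connectedComponentIn_of_disjoint_frontier hHo hHc hHF (fun x hx hxF => ?_) hzH
    by_contra hxH
    have hxK : x ∈ closure Δ := hfr (by rw [hHo.frontier_eq]; exact ⟨hx, hxH⟩)
    obtain ⟨y, hy, hyH⟩ := mem_closure_iff.1 hx Δ hΔ.1 (hfill x hxK hxF)
    exact hHK hyH (subset_closure hy)
  obtain ⟨d, hd⟩ := hΔ.2.1.nonempty
  have hΔcomp : Δ = connectedComponentIn (fatouSet f) d :=
    eq_connectedComponentIn_of_disjoint_frontier hΔ.1 hΔ.2.1.isPreconnected hΔ.2.2.2.1 hfill hd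
  have hopen : IsOpenMap f :=
    (AnalyticOnNhd.is_constant_or_isOpenMap (hf.differentiableOn.analyticOnNhd isOpen_univ)
      ).resolve_left fun ⟨c, hc⟩ => hΔ.iterate_ne_const 1 c hc
  have hFn : ∀ n, MapsTo f^[n] (fatouSet f) (fatouSet f) := (mapsTo_fatouSet hopen).iterate
  by_cases hw : IsWanderingDomain f H
  · refine Or.inr ⟨hw, (isBounded_closedBall (x := (0 : ℂ)) (r := M)).subset ?_⟩
    rintro _ hy
    obtain ⟨n, x, hx, rfl⟩ := mem_iUnion.1 hy
    simpa using hHM n x hx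
  left
  rw [IsWanderingDomain, not_and] at hw
  have := hw ⟨z, hHF hzH, hHcomp⟩
  push Not at this
  obtain ⟨m, n, hmn, x, hx, hxmn⟩ := this
  refine ⟨m, ?_⟩
  set W := connectedComponentIn (fatouSet f) (f^[m] x) with hW
  have hWsub : ∀ (k : ℕ) (y : ℂ) (S : Set ℂ), IsPreconnected S → S ⊆ fatouSet f → y ∈ S →
      f^[k] '' S ⊆ connectedComponentIn (fatouSet f) (f^[k] y) := fun k y S hS hSF hy =>
    (hS.image _ (hf.continuous.iterate k).continuousOn).subset_connectedComponentIn
      (mem_image_of_mem _ hy) ((image_mono hSF).trans (hFn k).image_subset)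
  have hHW : f^[m] '' H ⊆ W := hWsub m x H hHc hHF hx
  have hxmW : f^[m] x ∈ W := mem_connectedComponentIn (hFn m (hHF hx))
  have hWper : IsPeriodicFatouComponent f W := by
    refine ⟨⟨_, hFn m (hHF hx), rfl⟩, n - m, by omega, ?_⟩
    have := hWsub (n - m) (f^[m] x) W isPreconnected_connectedComponentIn
      (connectedComponentIn_subset _ _) hxmW
    rwa [← Function.iterate_add_apply, Nat.sub_add_cancel hmn.le, ← hxmn] at this
  have hΔper : IsPeriodicFatouComponent f Δ :=
    ⟨⟨d, hΔ.2.2.2.1 hd, hΔcomp⟩, 1, one_pos, (hΔ.image_iterate 1).subset⟩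
  by_cases hWΔ : W = Δ
  · exact hWΔ ▸ hHW
  exfalso
  have hsub := hsep W Δ hWper hΔper hWΔ
  have hHne : H ≠ univ := fun h => hHK (h ▸ mem_univ d) (subset_closure hd)
  obtain ⟨q, hq⟩ := nonempty_frontier_iff.2 ⟨⟨z, hzH⟩, hHne⟩
  have hmem : ∀ y ∈ frontier H, f^[m] y ∈ closure W ∩ closure Δ := fun y hy =>
    ⟨MapsTo.closure (mapsTo_iff_image_subset.2 hHW) (hf.continuous.iterate m)
      (frontier_subset_closure hy), hmaps m (hfr hy)⟩
  have hconst : EqOn f^[m] (fun _ => f^[m] q) H :=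
    Complex.eqOn_of_eqOn_frontier hbz (hf.iterate m).diffContOnCl
      (differentiable_const _).diffContOnCl fun y hy => hsub (hmem y hy) (hmem q hq)
  refine hΔ.iterate_ne_const m (f^[m] q) fun y => ?_
  exact congrFun (AnalyticOnNhd.eq_of_eventuallyEq
    ((hf.iterate m).differentiableOn.analyticOnNhd isOpen_univ) analyticOnNhd_const
    (hconst.eventuallyEq_of_mem (hHo.mem_nhds hzH))) y
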